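/- Let 2 ≤ k ≤ n−1 be integers and let p ∈ (0,1). Then M(n,k,p) = p^k if and only if p ≤ 1/(n−k+1). -/

import Mathlib

open scoped BigOperators

noncomputable section

/-- The probability, under the mass function `f` on `{0,1}^n`, of the event that
all coordinates in `S` equal `1` (i.e. `true`). -/
def prAll {n : ℕ} (f : (Fin n → Bool) → ℝ) (S : Finset (Fin n)) : ℝ :=
  ∑ x ∈ Finset.univ.filter (fun x : Fin n → Bool => ∀ i ∈ S, x i = true), f x

/-- `f` is the mass function of a probability measure on `{0,1}^n` making the
coordinate random variables `k`-wise independent Bernoulli(`p`) bits: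
`P(X_{i₁} = ⋯ = X_{i_s} = 1) = p ^ s` for all `1 ≤ s ≤ k`. -/
def memA (n k : ℕ) (p : ℝ) (f : (Fin n → Bool) → ℝ) : Prop :=
  (∀ x, 0 ≤ f x) ∧ (∑ x, f x) = 1 ∧
    ∀ S : Finset (Fin n), 1 ≤ S.card → S.card ≤ k → prAll f S = p ^ S.card

/-- `M n k p`: the maximum of `P(X₁ = ⋯ = Xₙ = 1)` over `A(n,k,p)`. -/
def M (n k : ℕ) (p : ℝ) : ℝ :=
  sSup {y : ℝ | ∃ f, memA n k p f ∧ prAll f Finset.univ = y}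

/-- Bonferroni polynomial `B(m,l,x) = Σ_{i=0}^{l} (−1)^i C(m,i) x^i`;
by convention it is `0` for negative `l`. -/
def bonf (m : ℕ) (l : ℤ) (x : ℝ) : ℝ :=
  if l < 0 then 0
  else ∑ i ∈ Finset.range (l.toNat + 1), (-1 : ℝ) ^ i * (m.choose i) * x ^ i

/-- The alternating sum `Σ_{j ≤ l} (-1)^j C(N,j) x^j`. -/
def altBinomSum (N l : ℕ) (x : ℝ) : ℝ :=
  ∑ j ∈ Finset.range (l + 1), (-1 : ℝ) ^ j * (N.choose j) * x ^ j

theorem altBinomSum_zero (N : ℕ) (x : ℝ) : altBinomSum N 0 x = 1 := by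
  simp [altBinomSum]

theorem altBinomSum_succ (N l : ℕ) (x : ℝ) :
    altBinomSum N (l + 1) x =
      altBinomSum N l x + (-1 : ℝ) ^ (l + 1) * (N.choose (l + 1)) * x ^ (l + 1) :=
  Finset.sum_range_succ _ _

theorem altBinomSum_pascal (N l : ℕ) (x : ℝ) :
    altBinomSum (N + 1) (l + 1) x = altBinomSum N (l + 1) x - x * altBinomSum N l x := by
  induction l with
  | zero =>
    simp only [altBinomSum_succ, altBinomSum_zero, Nat.choose_one_right, zero_add]
    push_cast
    ring
  | succ l ih =>
    rw [altBinomSum_succ (N + 1), ih, altBinomSum_succ N (l + 1), altBinomSum_succ N l,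
      Nat.choose_succ_succ]
    push_cast
    ring

theorem altBinomSum_self (r : ℕ) (x : ℝ) : altBinomSum r r x = (1 - x) ^ r := by
  rw [sub_eq_neg_add, add_pow, altBinomSum]
  refine Finset.sum_congr rfl fun j _ => ?_
  rw [neg_pow]
  ring

theorem choose_mul_le (m r : ℕ) :
    (m + 1 + r).choose (r + 1) ≤ (m + 1) * (m + r).choose r := by
  have h := Nat.add_one_mul_choose_eq (m + r) r
  refine Nat.le_of_mul_le_mul_right (c := r + 1) ?_ r.succ_pos
  rw [show m + 1 + r = m + r + 1 by ring, ← h]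
  nlinarith [Nat.zero_le (m * r * (m + r).choose r)]

/-- Writing `altBinomSum (m+r) r x` as an alternating sum of decreasing terms shows that it is
nonnegative for `x ≤ 1/(m+1)`. -/
theorem altBinomSum_bounds (m : ℕ) (x : ℝ) (hx : 0 ≤ x) (hx' : x * (m + 2) ≤ 1) (r : ℕ) :
    0 ≤ altBinomSum (m + 1 + r) r x ∧
      (Even r → ((m + r).choose r : ℝ) * x ^ r ≤ altBinomSum (m + 1 + r) r x) := by
  have hx1 : 0 ≤ 1 - x := by nlinarith [Nat.cast_nonneg (α := ℝ) m]
  induction r with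
  | zero => simp [altBinomSum_zero]
  | succ r ih =>
    have hrec : altBinomSum (m + 1 + (r + 1)) (r + 1) x =
        (1 - x) * altBinomSum (m + 1 + r) r x +
          (-1 : ℝ) ^ (r + 1) * ((m + 1 + r).choose (r + 1) * x ^ (r + 1)) := by
      rw [← add_assoc, altBinomSum_pascal, altBinomSum_succ]
      ring
    have hc : (0 : ℝ) ≤ (m + 1 + r).choose (r + 1) * x ^ (r + 1) := by positivity
    have hmul := mul_nonneg hx1 ih.1
    rw [hrec, show m + (r + 1) = m + 1 + r by ring]
    rcases Nat.even_or_odd r with hr | hr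
    · have hodd : (-1 : ℝ) ^ (r + 1) = -1 := hr.add_one.neg_one_pow
      refine ⟨?_, fun h => absurd h (Nat.not_even_iff_odd.2 hr.add_one)⟩
      have h1 : ((m + 1 + r).choose (r + 1) : ℝ) ≤ (m + 1) * (m + r).choose r := by
        exact_mod_cast choose_mul_le m r
      have h2 := mul_le_mul_of_nonneg_right h1 (pow_nonneg hx (r + 1))
      have h3 := mul_le_mul_of_nonneg_left (ih.2 hr) hx1
      have h4 : (0 : ℝ) ≤ (m + r).choose r * x ^ r := by positivity
      have h5 := mul_nonneg h4 (show 0 ≤ 1 - x - (m + 1) * x by linarith)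
      rw [hodd]
      rw [pow_succ] at h2 ⊢
      linarith
    · have heven : (-1 : ℝ) ^ (r + 1) = 1 := hr.add_one.neg_one_pow
      rw [heven]
      exact ⟨by linarith, fun _ => by linarith⟩

theorem sum_choose_mul_altBinomSum (m d : ℕ) (x : ℝ) :
    (1 - x) * ∑ q ∈ Finset.HasAntidiagonal.antidiagonal d,
      ((m + d + 1).choose q.1 : ℝ) * x ^ q.1 * altBinomSum (m + q.2) q.2 x = 1 - x ^ (d + 1) := by
  induction m with
  | zero =>
    have h := (Commute.all x (1 - x)).add_pow' (d + 1)
    rw [Finset.Nat.sum_antidiagonal_succ', add_sub_cancel, one_pow] at h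
    refine eq_sub_of_add_eq' (Eq.trans ?_ h.symm)
    rw [Finset.mul_sum]
    simp only [zero_add, altBinomSum_self, Nat.choose_self, pow_zero, nsmul_eq_mul, Nat.cast_one,
      one_mul, mul_one]
    congr 1
    refine Finset.sum_congr rfl fun q _ => ?_
    ring
  | succ m ih =>
    rw [← ih]
    congr 1
    cases d with
    | zero => simp [altBinomSum_zero]
    | succ d =>
      have hrec (j : ℕ) : altBinomSum (m + (j + 1)) (j + 1) x =
          altBinomSum (m + 1 + (j + 1)) (j + 1) x + x * altBinomSum (m + 1 + j) j x := by
        rw [show m + 1 + (j + 1) = m + 1 + j + 1 by ring, altBinomSum_pascal,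
          show m + (j + 1) = m + 1 + j by ring]
        ring
      have hR : ∑ q ∈ Finset.HasAntidiagonal.antidiagonal (d + 1), ((m + (d + 1) + 1).choose q.1 : ℝ) * x ^ q.1 *
            altBinomSum (m + q.2) q.2 x =
          ∑ q ∈ Finset.HasAntidiagonal.antidiagonal (d + 1), ((m + (d + 1) + 1).choose q.1 : ℝ) * x ^ q.1 *
            altBinomSum (m + 1 + q.2) q.2 x +
          x * ∑ q ∈ Finset.HasAntidiagonal.antidiagonal d, ((m + (d + 1) + 1).choose q.1 : ℝ) * x ^ q.1 *
            altBinomSum (m + 1 + q.2) q.2 x := by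
        rw [Finset.Nat.sum_antidiagonal_succ', Finset.Nat.sum_antidiagonal_succ', Finset.mul_sum,
          add_assoc (_ * _ : ℝ), ← Finset.sum_add_distrib]
        simp only [altBinomSum_zero, hrec]
        congr 1
        refine Finset.sum_congr rfl fun q _ => ?_
        ring
      rw [hR, Finset.Nat.sum_antidiagonal_succ, Finset.Nat.sum_antidiagonal_succ, Finset.mul_sum,
        add_assoc (_ * _ : ℝ), ← Finset.sum_add_distrib]
      simp only [Nat.choose_zero_right]
      congr 1
      refine Finset.sum_congr rfl fun q _ => ?_
      rw [show m + 1 + (d + 1) + 1 = m + (d + 1) + 1 + 1 by ring, Nat.choose_succ_succ]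
      push_cast
      ring

theorem prAll_comp_card {n : ℕ} (g : ℕ → ℝ) (S : Finset (Fin n)) :
    prAll (fun x => g (Finset.univ.filter fun i => x i = true).card) S =
      ∑ i ∈ Finset.range (n - S.card + 1), ((n - S.card).choose i : ℝ) * g (S.card + i) := by
  have h := Finset.sum_powerset_apply_card (fun i => g (S.card + i)) (x := Sᶜ)
  rw [Finset.card_compl, Fintype.card_fin] at h
  simp only [nsmul_eq_mul] at h
  rw [← h, prAll]
  refine Finset.sum_nbij' (fun x => Sᶜ.filter fun i => x i = true)
    (fun V i => decide (i ∈ S ∪ V)) ?_ ?_ ?_ ?_ ?_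
  · intro x _
    simp
  · intro V _
    simp +contextual
  · intro x hx
    simp only [Finset.mem_filter, Finset.mem_univ, true_and] at hx
    funext i
    by_cases hi : i ∈ S <;> simp [hi, hx]
  · intro V hV
    rw [Finset.mem_powerset] at hV
    ext i
    have := @hV i
    simp only [Finset.mem_compl] at this
    simp only [Finset.mem_filter, Finset.mem_compl, decide_eq_true_eq, Finset.mem_union]
    tauto
  · intro x hx
    simp only [Finset.mem_filter, Finset.mem_univ, true_and] at hx
    rw [← Finset.card_union_of_disjoint
      (Finset.disjoint_left.2 fun i hi h => (Finset.mem_compl.1 (Finset.mem_filter.1 h).1) hi)]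
    congr 2
    ext i
    have := hx i
    simp only [Finset.mem_filter, Finset.mem_univ, true_and, Finset.mem_union, Finset.mem_compl]
    tauto

theorem prAll_mono {n : ℕ} {f : (Fin n → Bool) → ℝ} (hf : ∀ x, 0 ≤ f x) {S T : Finset (Fin n)}
    (h : S ⊆ T) : prAll f T ≤ prAll f S := by
  refine Finset.sum_le_sum_of_subset_of_nonneg (fun x hx => ?_) fun x _ _ => hf x
  simp only [Finset.mem_filter, Finset.mem_univ, true_and] at hx ⊢
  exact fun i hi => hx i (h hi)

theorem prAll_empty {n : ℕ} (f : (Fin n → Bool) → ℝ) : prAll f ∅ = ∑ x, f x := by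
  simp [prAll]

theorem memA.prAll_eq {n k : ℕ} {p : ℝ} {f : (Fin n → Bool) → ℝ} (h : memA n k p f)
    {S : Finset (Fin n)} (hS : S.card ≤ k) : prAll f S = p ^ S.card := by
  rcases S.eq_empty_or_nonempty with rfl | hne
  · simpa [prAll_empty] using h.2.1
  · exact h.2.2 S hne.card_pos hS

theorem memA.prAll_univ_le {n k : ℕ} {p : ℝ} {f : (Fin n → Bool) → ℝ} (h : memA n k p f)
    (hkn : k ≤ n) : prAll f Finset.univ ≤ p ^ k := by
  obtain ⟨T, -, hT⟩ := Finset.exists_subset_card_eq (s := (Finset.univ : Finset (Fin n)))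
    (n := k) (by simpa using hkn)
  calc prAll f Finset.univ ≤ prAll f T := prAll_mono h.1 (Finset.subset_univ T)
    _ = p ^ k := by rw [h.prAll_eq hT.le, hT]

/-- The weight of a vector with `t` ones under the exchangeable measure on `{0,1}^n` that is
supported on the all-ones vector and the vectors with fewer than `k` ones. -/
def extremalWeight (n k : ℕ) (p : ℝ) (t : ℕ) : ℝ :=
  if t = n then p ^ k
  else if k ≤ t then 0
  else p ^ t * ((1 - p) * altBinomSum (n - k + (k - 1 - t)) (k - 1 - t) p)

theorem extremalWeight_nonneg (m k : ℕ) (p : ℝ) (hp : 0 ≤ p) (hp' : p * (m + 2) ≤ 1) (t : ℕ) :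
    0 ≤ extremalWeight (k + (m + 1)) k p t := by
  have hp1 : 0 ≤ 1 - p := by nlinarith [Nat.cast_nonneg (α := ℝ) m]
  unfold extremalWeight
  split_ifs
  · positivity
  · exact le_rfl
  · rw [Nat.add_sub_cancel_left]
    exact mul_nonneg (pow_nonneg hp t)
      (mul_nonneg hp1 (altBinomSum_bounds m p hp hp' (k - 1 - t)).1)

theorem sum_choose_mul_extremalWeight (m s d : ℕ) (p : ℝ) :
    ∑ i ∈ Finset.range (d + m + 1),
      ((d + m).choose i : ℝ) * extremalWeight (s + d + m) (s + d) p (s + i) = p ^ s := by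
  rw [Finset.sum_range_succ, Finset.sum_range_add]
  have hmid : ∑ i ∈ Finset.range m, ((d + m).choose (d + i) : ℝ) *
      extremalWeight (s + d + m) (s + d) p (s + (d + i)) = 0 := by
    refine Finset.sum_eq_zero fun i hi => ?_
    rw [Finset.mem_range] at hi
    rw [extremalWeight, if_neg (by omega), if_pos (by omega), mul_zero]
  have hlast : extremalWeight (s + d + m) (s + d) p (s + (d + m)) = p ^ (s + d) := by
    rw [extremalWeight, if_pos (by omega)]
  rw [hmid, hlast]
  cases d with
  | zero => simp
  | succ d =>
    have h := sum_choose_mul_altBinomSum m d p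
    rw [Finset.Nat.sum_antidiagonal_eq_sum_range_succ_mk, Finset.mul_sum] at h
    have hfirst : ∑ i ∈ Finset.range (d + 1), ((d + 1 + m).choose i : ℝ) *
        extremalWeight (s + (d + 1) + m) (s + (d + 1)) p (s + i) = p ^ s * (1 - p ^ (d + 1)) := by
      rw [← h, Finset.mul_sum]
      refine Finset.sum_congr rfl fun i hi => ?_
      rw [Finset.mem_range] at hi
      rw [extremalWeight, if_neg (by omega), if_neg (by omega), Nat.add_sub_cancel_left,
        show s + (d + 1) - 1 - (s + i) = d - i by omega, show d + 1 + m = m + d + 1 by ring]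
      ring
    rw [hfirst, Nat.choose_self]
    push_cast
    ring

theorem exists_memA_prAll_univ_eq (m k : ℕ) (p : ℝ) (hp : 0 ≤ p) (hp' : p * (m + 2) ≤ 1) :
    ∃ f, memA (k + (m + 1)) k p f ∧ prAll f Finset.univ = p ^ k := by
  have key (S : Finset (Fin (k + (m + 1)))) (hS : S.card ≤ k) :
      prAll (fun x => extremalWeight (k + (m + 1)) k p
        (Finset.univ.filter fun i => x i = true).card) S = p ^ S.card := by
    rw [prAll_comp_card]
    obtain ⟨d, hd⟩ := Nat.exists_eq_add_of_le hS
    have h := sum_choose_mul_extremalWeight (m + 1) S.card d p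
    rw [← hd] at h
    rwa [show k + (m + 1) - S.card = d + (m + 1) by omega]
  refine ⟨_, ⟨fun x => extremalWeight_nonneg m k p hp hp' _, ?_, fun S _ hS => key S hS⟩, ?_⟩
  · simpa [prAll_empty] using key ∅ (by simp)
  · rw [prAll_comp_card]
    simp [extremalWeight]

/-- The second-moment bound obtained from `(Z - 1)(Z - 2) ≥ 0`, where `Z` counts the ones outside
a fixed set of `k` coordinates that are all equal to one. -/
theorem memA.prAll_univ_mul_le {m k : ℕ} {p : ℝ} {f : (Fin (k + (m + 3)) → Bool) → ℝ}
    (h : memA (k + (m + 3)) (k + 2) p f) :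
    prAll f Finset.univ * ((m + 2) * (m + 1)) ≤
      p ^ k * ((m + 3) * (m + 2) * p ^ 2 - 2 * (m + 3) * p + 2) := by
  obtain ⟨T, -, hT⟩ := Finset.exists_subset_card_eq
    (s := (Finset.univ : Finset (Fin (k + (m + 3))))) (n := k) (by simp)
  have hTc : (Tᶜ).card = m + 3 := by rw [Finset.card_compl, Fintype.card_fin, hT]; omega
  let A := Finset.univ.filter fun x : Fin (k + (m + 3)) → Bool => ∀ i ∈ T, x i = true
  let e : Fin (k + (m + 3)) → (Fin (k + (m + 3)) → Bool) → ℝ := fun i x => if x i then 1 else 0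
  have h0 : ∑ x ∈ A, f x = p ^ k := by
    have := h.prAll_eq (S := T) (by omega)
    rwa [hT] at this
  have hone (i) : ∑ x ∈ A, f x * e i x = prAll f (insert i T) := by
    simp only [e, mul_ite, mul_one, mul_zero]
    rw [← Finset.sum_filter, prAll, Finset.filter_filter]
    refine Finset.sum_congr (Finset.filter_congr fun x _ => ?_) fun _ _ => rfl
    rw [Finset.forall_mem_insert, and_comm]
  have htwo (i j) : ∑ x ∈ A, f x * (e i x * e j x) = prAll f (insert i (insert j T)) := by
    simp only [e, ← ite_and, mul_ite, mul_one, mul_zero]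
    rw [← Finset.sum_filter, prAll, Finset.filter_filter]
    refine Finset.sum_congr (Finset.filter_congr fun x _ => ?_) fun _ _ => rfl
    rw [Finset.forall_mem_insert, Finset.forall_mem_insert]
    tauto
  have hp1 (i) (hi : i ∈ Tᶜ) : prAll f (insert i T) = p ^ (k + 1) := by
    have hc := Finset.card_insert_of_notMem (Finset.mem_compl.1 hi)
    rw [h.prAll_eq (by omega), hc, hT]
  have hp2 (i) (hi : i ∈ Tᶜ) (j) (hj : j ∈ Tᶜ.erase i) :
      prAll f (insert i (insert j T)) = p ^ (k + 2) := by
    rw [Finset.mem_erase, Finset.mem_compl] at hj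
    have hc := Finset.card_insert_of_notMem hj.2
    have hc' := Finset.card_insert_of_notMem (s := insert j T) (a := i)
      (by rw [Finset.mem_insert, not_or]; exact ⟨hj.1.symm, Finset.mem_compl.1 hi⟩)
    rw [h.prAll_eq (by omega), hc', hc, hT]
  have hZ : ∑ x ∈ A, f x * ∑ i ∈ Tᶜ, e i x = (m + 3) * p ^ (k + 1) := by
    simp only [Finset.mul_sum]
    rw [Finset.sum_comm]
    simp only [hone]
    rw [Finset.sum_congr rfl hp1, Finset.sum_const, hTc, nsmul_eq_mul]
    push_cast
    ring
  have hZZ : ∑ x ∈ A, f x * ((∑ i ∈ Tᶜ, e i x) * ∑ i ∈ Tᶜ, e i x) =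
      (m + 3) * (p ^ (k + 1) + (m + 2) * p ^ (k + 2)) := by
    simp only [Finset.sum_mul_sum]
    simp only [Finset.mul_sum]
    rw [Finset.sum_comm]
    have hinner (i) (hi : i ∈ Tᶜ) : ∑ x ∈ A, ∑ j ∈ Tᶜ, f x * (e i x * e j x) =
        p ^ (k + 1) + (m + 2) * p ^ (k + 2) := by
      rw [Finset.sum_comm]
      simp only [htwo]
      rw [← Finset.add_sum_erase _ _ hi, Finset.insert_idem, hp1 i hi,
        Finset.sum_congr rfl (hp2 i hi), Finset.sum_const, Finset.card_erase_of_mem hi, hTc,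
        nsmul_eq_mul]
      push_cast
      ring
    rw [Finset.sum_congr rfl hinner, Finset.sum_const, hTc, nsmul_eq_mul]
    push_cast
    ring
  have hnonneg (x) :
      0 ≤ f x * ((∑ i ∈ Tᶜ, e i x - 1) * (∑ i ∈ Tᶜ, e i x - 2)) := by
    refine mul_nonneg (h.1 x) ?_
    have hcard : ∑ i ∈ Tᶜ, e i x = ((Tᶜ.filter fun i => x i = true).card : ℝ) := by
      simp [e]
    rw [hcard]
    rcases Nat.lt_or_ge (Tᶜ.filter fun i => x i = true).card 2 with hlt | hge
    · have : ((Tᶜ.filter fun i => x i = true).card : ℝ) ≤ 1 := by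
        exact_mod_cast Nat.le_of_lt_succ hlt
      exact mul_nonneg_of_nonpos_of_nonpos (by linarith) (by linarith)
    · have : (2 : ℝ) ≤ (Tᶜ.filter fun i => x i = true).card := by exact_mod_cast hge
      exact mul_nonneg (by linarith) (by linarith)
  have hsingle := Finset.single_le_sum (s := A) (fun x _ => hnonneg x)
    (a := fun _ => true) (by simp [A])
  have huniv : prAll f Finset.univ = f fun _ => true := by
    rw [prAll, Finset.sum_eq_single fun _ => true]
    · intro x hx hne
      exact absurd (funext fun i => (Finset.mem_filter.1 hx).2 i (Finset.mem_univ i)) hne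
    · simp
  have htrue : ∑ i ∈ Tᶜ, e i (fun _ => true) = m + 3 := by
    simp only [e, if_true, Finset.sum_const, hTc, nsmul_eq_mul, mul_one]
    push_cast
    ring
  have hexpand : ∑ x ∈ A, f x * ((∑ i ∈ Tᶜ, e i x - 1) * (∑ i ∈ Tᶜ, e i x - 2)) =
      ∑ x ∈ A, f x * ((∑ i ∈ Tᶜ, e i x) * ∑ i ∈ Tᶜ, e i x) -
        3 * ∑ x ∈ A, f x * ∑ i ∈ Tᶜ, e i x + 2 * ∑ x ∈ A, f x := by
    rw [Finset.mul_sum, Finset.mul_sum, ← Finset.sum_sub_distrib, ← Finset.sum_add_distrib]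
    refine Finset.sum_congr rfl fun x _ => ?_
    ring
  rw [hexpand, h0, hZ, hZZ] at hsingle
  simp only [htrue] at hsingle
  rw [huniv]
  refine le_trans (le_of_eq ?_) (hsingle.trans (le_of_eq ?_)) <;> ring

/-- `M(n,k,p) = p^k` if and only if `p ≤ 1/(n-k+1)`. -/
theorem stmt6 (n k : ℕ) (hk : 2 ≤ k) (hkn : k + 1 ≤ n) (p : ℝ) (hp : p ∈ Set.Ioo (0:ℝ) 1) :
    M n k p = p ^ k ↔ p ≤ 1 / ((n:ℝ) - (k:ℝ) + 1) := by
  obtain ⟨k, rfl⟩ := Nat.exists_eq_add_of_le' hk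
  obtain ⟨m, rfl⟩ := Nat.exists_eq_add_of_le hkn
  obtain ⟨hp0, hp1⟩ := hp
  have hm : (0 : ℝ) < m + 2 := by positivity
  rw [show ((k + 2 + 1 + m : ℕ) : ℝ) - ((k + 2 : ℕ) : ℝ) + 1 = m + 2 by push_cast; ring,
    le_div_iff₀ hm]
  constructor
  · intro hM
    by_contra! hlt
    have hn : k + 2 + 1 + m = k + (m + 3) := by ring
    rw [hn, M] at hM
    rcases Set.eq_empty_or_nonempty
      {y : ℝ | ∃ f, memA (k + (m + 3)) (k + 2) p f ∧ prAll f Finset.univ = y} with he | hne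
    · rw [he, Real.sSup_empty] at hM
      exact (pow_pos hp0 (k + 2)).ne hM
    · have hpos : (0 : ℝ) < (m + 2) * (m + 1) := by positivity
      have hle := csSup_le hne (a := p ^ k * ((m + 3) * (m + 2) * p ^ 2 - 2 * (m + 3) * p + 2) /
          ((m + 2) * (m + 1))) (by
        rintro y ⟨f, hf, rfl⟩
        rw [le_div_iff₀ hpos]
        exact hf.prAll_univ_mul_le)
      rw [hM, le_div_iff₀ hpos, pow_add] at hle
      have hstrict := mul_pos (pow_pos hp0 k) (mul_pos (sub_pos.2 hp1) (sub_pos.2 hlt))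
      nlinarith
  · intro hle
    have hn : k + 2 + 1 + m = k + 2 + (m + 1) := by ring
    rw [hn]
    refine IsGreatest.csSup_eq ⟨exists_memA_prAll_univ_eq m (k + 2) p hp0.le hle, ?_⟩
    rintro y ⟨f, hf, rfl⟩
    exact hf.prAll_univ_le (Nat.le_add_right _ _)
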